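/- arXiv:2201.07579 — 5 statements merged into one kernel-verified Lean document; each statement's English description precedes it below -/
import Mathlib

section
/- Let C ⊆ F_q^{n×m} (n ≤ m) be a rank-metric code which contains an optimal anticode of dimension sm for some 1 ≤ s ≤ n. Then for every 1 ≤ i ≤ s and every j with (i−1)m + 1 ≤ j ≤ im, the minimum dimension of an optimal anticode A ⊆ F_q^{n×m} with dim(A ∩ C) ≥ j equals im; that is, a_j(C) = i. -/
open Matrix

/-- The maximum rank of a rank-metric code (an `𝔽`-linear subspace of `n × m` matrices). -/
noncomputable def maxrk {𝔽 : Type*} [Field 𝔽] {n m : ℕ}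
    (C : Submodule 𝔽 (Matrix (Fin n) (Fin m) 𝔽)) : ℕ :=
  sSup (Matrix.rank '' (C : Set (Matrix (Fin n) (Fin m) 𝔽)))

/-- The dual code with respect to the trace bilinear form `⟨M, N⟩ = Tr(M Nᵗ)`. -/
def dualCode {𝔽 : Type*} [Field 𝔽] {n m : ℕ}
    (C : Submodule 𝔽 (Matrix (Fin n) (Fin m) 𝔽)) :
    Submodule 𝔽 (Matrix (Fin n) (Fin m) 𝔽) where
  carrier := {M | ∀ N ∈ C, Matrix.trace (M * Nᵀ) = 0}
  add_mem' := by
    intro a b ha hb N hN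
    show Matrix.trace ((a + b) * Nᵀ) = 0
    rw [Matrix.add_mul, Matrix.trace_add, ha N hN, hb N hN, add_zero]
  zero_mem' := by
    intro N hN
    simp
  smul_mem' := by
    intro c a ha N hN
    show Matrix.trace ((c • a) * Nᵀ) = 0
    rw [Matrix.smul_mul, Matrix.trace_smul, ha N hN, smul_zero]

/-- `C` is an optimal anticode if `dim C = m * maxrk C`. -/
def isOptAnticode {𝔽 : Type*} [Field 𝔽] {n m : ℕ}
    (C : Submodule 𝔽 (Matrix (Fin n) (Fin m) 𝔽)) : Prop :=
  Module.finrank 𝔽 C = m * maxrk C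

/-- `C` is a quasi optimal anticode if `m ∤ dim C` and `maxrk C = ⌈dim C / m⌉`. -/
def isQOAC {𝔽 : Type*} [Field 𝔽] {n m : ℕ}
    (C : Submodule 𝔽 (Matrix (Fin n) (Fin m) 𝔽)) : Prop :=
  ¬ (m ∣ Module.finrank 𝔽 C) ∧
    (maxrk C : ℤ) = ⌈(Module.finrank 𝔽 C : ℚ) / (m : ℚ)⌉

/-- `C` is a dually quasi optimal anticode if both `C` and `C^⊥` are qOACs. -/
def isDuallyQOAC {𝔽 : Type*} [Field 𝔽] {n m : ℕ}
    (C : Submodule 𝔽 (Matrix (Fin n) (Fin m) 𝔽)) : Prop :=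
  isQOAC C ∧ isQOAC (dualCode C)

/-- The code of matrices vanishing at all positions `(i, j)` with `¬ P i j`. -/
def zeroOutside {𝔽 : Type*} [Field 𝔽] {n m : ℕ} (P : Fin n → Fin m → Prop) :
    Submodule 𝔽 (Matrix (Fin n) (Fin m) 𝔽) where
  carrier := {M | ∀ i j, ¬ P i j → M i j = 0}
  add_mem' := by
    intro a b ha hb i j h
    simp [Matrix.add_apply, ha i j h, hb i j h]
  zero_mem' := by
    intro i j h
    simp
  smul_mem' := by
    intro c a ha i j h
    simp [Matrix.smul_apply, ha i j h]

/-- `Mat(V)`: the matrices all of whose columns lie in `V ⊆ 𝔽^n`. -/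
def matCol {𝔽 : Type*} [Field 𝔽] {n m : ℕ} (V : Submodule 𝔽 (Fin n → 𝔽)) :
    Submodule 𝔽 (Matrix (Fin n) (Fin m) 𝔽) where
  carrier := {M | ∀ j, (fun i => M i j) ∈ V}
  add_mem' := by
    intro a b ha hb j
    exact V.add_mem (ha j) (hb j)
  zero_mem' := by
    intro j
    exact V.zero_mem
  smul_mem' := by
    intro c a ha j
    exact V.smul_mem c (ha j)

/-- `Mat(U)ᵗ`: the matrices all of whose rows lie in `U ⊆ 𝔽^m`. -/
def matRow {𝔽 : Type*} [Field 𝔽] {n m : ℕ} (U : Submodule 𝔽 (Fin m → 𝔽)) :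
    Submodule 𝔽 (Matrix (Fin n) (Fin m) 𝔽) where
  carrier := {M | ∀ i, M i ∈ U}
  add_mem' := by
    intro a b ha hb i
    exact U.add_mem (ha i) (hb i)
  zero_mem' := by
    intro i
    exact U.zero_mem
  smul_mem' := by
    intro c a ha i
    exact U.smul_mem c (ha i)

/-- `⟨e_1, …, e_s⟩ ⊆ 𝔽^ℓ`: the span of the first `s` canonical basis vectors. -/
def spanFirst (𝔽 : Type*) [Field 𝔽] (ℓ s : ℕ) : Submodule 𝔽 (Fin ℓ → 𝔽) :=
  Submodule.span 𝔽 ((fun i : Fin ℓ => Pi.single i (1 : 𝔽)) '' {i : Fin ℓ | (i : ℕ) < s})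

/-- Orthogonal complement with respect to the standard dot product on `𝔽^ℓ`. -/
def perp {𝔽 : Type*} [Field 𝔽] {ℓ : ℕ} (W : Submodule 𝔽 (Fin ℓ → 𝔽)) :
    Submodule 𝔽 (Fin ℓ → 𝔽) where
  carrier := {v | ∀ w ∈ W, ∑ i, v i * w i = 0}
  add_mem' := by
    intro a b ha hb w hw
    simp [add_mul, Finset.sum_add_distrib, ha w hw, hb w hw]
  zero_mem' := by
    intro w hw
    simp
  smul_mem' := by
    intro c a ha w hw
    simp [mul_assoc, ← Finset.mul_sum, ha w hw]

/-- Equivalence of rank-metric codes: `C = {N A M : A ∈ D}` for invertible `N, M`, or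
(when `n = m`) `C = {N Aᵗ M : A ∈ D}` for invertible `N, M`. -/
def equivCode {𝔽 : Type*} [Field 𝔽] {n m : ℕ}
    (C D : Submodule 𝔽 (Matrix (Fin n) (Fin m) 𝔽)) : Prop :=
  (∃ (N : Matrix (Fin n) (Fin n) 𝔽) (M : Matrix (Fin m) (Fin m) 𝔽),
      IsUnit N ∧ IsUnit M ∧
      (C : Set (Matrix (Fin n) (Fin m) 𝔽)) = (fun A : Matrix (Fin n) (Fin m) 𝔽 => N * A * M) '' (D : Set (Matrix (Fin n) (Fin m) 𝔽))) ∨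
  (∃ (h : n = m) (N : Matrix (Fin n) (Fin n) 𝔽) (M : Matrix (Fin m) (Fin m) 𝔽),
      IsUnit N ∧ IsUnit M ∧
      (C : Set (Matrix (Fin n) (Fin m) 𝔽)) =
        (fun A : Matrix (Fin n) (Fin m) 𝔽 =>
          N * (Matrix.reindex (finCongr h.symm) (finCongr h) Aᵀ) * M) ''
          (D : Set (Matrix (Fin n) (Fin m) 𝔽)))

/-- The Gaussian `q`-binomial coefficient, as a rational number. -/
def gaussBinom (q a r : ℕ) : ℚ :=
  (∏ i ∈ Finset.range r, ((q : ℚ) ^ a - (q : ℚ) ^ i)) /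
    (∏ i ∈ Finset.range r, ((q : ℚ) ^ r - (q : ℚ) ^ i))

/-- `φ_q(a, b, r)`: the number of rank-`r` matrices in `𝔽_q^{a×b}`. -/
def phiq (q a b r : ℕ) : ℚ :=
  gaussBinom q a r * ∏ i ∈ Finset.range r, ((q : ℚ) ^ b - (q : ℚ) ^ i)

namespace OptAnticode

open Module Submodule

variable {F V E : Type*} [Field F] [AddCommGroup V] [Module F V] [AddCommGroup E] [Module F E]

/-- The maps in `B` which vanish on the first `t` vectors of `b`. -/
def vanishing (B : Submodule F (V →ₗ[F] E)) (b : ℕ → V) (t : ℕ) : Submodule F (V →ₗ[F] E) where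
  carrier := {A | A ∈ B ∧ ∀ j < t, A (b j) = 0}
  add_mem' := by
    rintro A A' ⟨hA, hA0⟩ ⟨hA', hA0'⟩
    exact ⟨B.add_mem hA hA', fun j hj => by simp [hA0 j hj, hA0' j hj]⟩
  zero_mem' := ⟨B.zero_mem, fun _ _ => rfl⟩
  smul_mem' := by
    rintro c A ⟨hA, hA0⟩
    exact ⟨B.smul_mem c hA, fun j hj => by simp [hA0 j hj]⟩

/-- The space of values at `b t` of the maps in `B` which vanish on `b 0, …, b (t - 1)`. -/
def pivotSpace (B : Submodule F (V →ₗ[F] E)) (b : ℕ → V) (t : ℕ) : Submodule F E :=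
  (vanishing B b t).map (LinearMap.applyₗ (b t))

lemma mem_vanishing {B : Submodule F (V →ₗ[F] E)} {b : ℕ → V} {t : ℕ} {A : V →ₗ[F] E} :
    A ∈ vanishing B b t ↔ A ∈ B ∧ ∀ j < t, A (b j) = 0 := Iff.rfl

lemma mem_pivotSpace {B : Submodule F (V →ₗ[F] E)} {b : ℕ → V} {t : ℕ} {x : E} :
    x ∈ pivotSpace B b t ↔ ∃ A ∈ B, (∀ j < t, A (b j) = 0) ∧ A (b t) = x := by
  simp [pivotSpace, mem_vanishing, and_assoc]

lemma pivotSpace_congr {B : Submodule F (V →ₗ[F] E)} {b c : ℕ → V} {t : ℕ}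
    (h : ∀ j ≤ t, b j = c j) : pivotSpace B b t = pivotSpace B c t := by
  ext x
  simp only [mem_pivotSpace]
  refine exists_congr fun A => and_congr_right fun _ => ?_
  rw [h t le_rfl]
  refine and_congr_left fun _ => forall₂_congr fun j hj => ?_
  rw [h j hj.le]

lemma pivotSpace_le_map (B : Submodule F (V →ₗ[F] E)) (b : ℕ → V) (t : ℕ) :
    pivotSpace B b t ≤ B.map (LinearMap.applyₗ (b t)) :=
  Submodule.map_mono fun _ h => h.1

lemma pivotSpace_zero (B : Submodule F (V →ₗ[F] E)) (b : ℕ → V) :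
    pivotSpace B b 0 = B.map (LinearMap.applyₗ (b 0)) := by
  ext x
  simp [mem_pivotSpace]

lemma card_le_finrank_range [FiniteDimensional F V] {b : ℕ → V} {M : V →ₗ[F] E} {R : Finset ℕ}
    (h : LinearIndepOn F (fun i => M (b i)) (R : Set ℕ)) : R.card ≤ finrank F M.range := by
  have h1 : LinearIndependent F (fun i : R => (⟨M (b i), ⟨b i, rfl⟩⟩ : M.range)) :=
    LinearIndependent.of_comp M.range.subtype h
  simpa using h1.fintype_card_le_finrank

lemma finrank_vanishing [FiniteDimensional F V] [FiniteDimensional F E]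
    (B : Submodule F (V →ₗ[F] E)) (b : ℕ → V) (t : ℕ) :
    finrank F (vanishing B b t) =
      finrank F (pivotSpace B b t) + finrank F (vanishing B b (t + 1)) := by
  have h := LinearMap.finrank_range_add_finrank_ker
    ((LinearMap.applyₗ (b t) : (V →ₗ[F] E) →ₗ[F] E).domRestrict (vanishing B b t))
  rw [← h, LinearMap.range_domRestrict, LinearMap.ker_domRestrict]
  have hle : vanishing B b (t + 1) ≤ vanishing B b t := fun A hA =>
    ⟨hA.1, fun j hj => hA.2 j (by omega)⟩
  have hker : (LinearMap.applyₗ (b t) : (V →ₗ[F] E) →ₗ[F] E).ker.comap (vanishing B b t).subtype =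
      (vanishing B b (t + 1)).comap (vanishing B b t).subtype := by
    ext ⟨A, hAB, hA⟩
    refine ⟨fun h => ⟨hAB, fun j hj => ?_⟩, fun h => h.2 t (by omega)⟩
    rcases Nat.lt_succ_iff_lt_or_eq.1 hj with hj | rfl
    · exact hA j hj
    · exact h
  rw [hker, (Submodule.comapSubtypeEquivOfLe hle).finrank_eq, pivotSpace]

lemma finrank_eq_sum [FiniteDimensional F V] [FiniteDimensional F E]
    (B : Submodule F (V →ₗ[F] E)) (b : ℕ → V) (n : ℕ)
    (hb : span F (b '' Set.Iio n) = ⊤) :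
    finrank F B = ∑ i ∈ Finset.range n, finrank F (pivotSpace B b i) := by
  have key : ∀ t, finrank F B =
      ∑ i ∈ Finset.range t, finrank F (pivotSpace B b i) + finrank F (vanishing B b t) := by
    intro t
    induction t with
    | zero =>
      have : vanishing B b 0 = B := by ext; simp [mem_vanishing]
 
      rw [Finset.sum_range_zero, zero_add, this]
    | succ t ih => rw [ih, Finset.sum_range_succ, finrank_vanishing, add_assoc]
  have h0 : vanishing B b n = ⊥ := by
    rw [eq_bot_iff]
    rintro A ⟨-, hA⟩
    have : A = 0 := by
      apply LinearMap.ext_on hb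
      rintro _ ⟨j, hj, rfl⟩
      simpa using hA j hj
    simp [this]
  rw [key n, h0, finrank_bot, add_zero]

/-- Greedy choice of an independent transversal of a family of subspaces, extending a given
independent family. -/
lemma exists_transversal [FiniteDimensional F E]
    (U : ℕ → Submodule F E) (R₀ : Finset ℕ) (u₀ : ℕ → E)
    (h₀ : LinearIndepOn F u₀ (R₀ : Set ℕ)) (k : ℕ) : ∀ I : Finset ℕ, Disjoint R₀ I →
    (∀ j < k, k - j ≤ (I.filter fun i => j + R₀.card < finrank F (U i)).card) →
    ∃ R ⊆ I, R.card = k ∧ ∃ u : ℕ → E, (∀ i ∈ R₀, u i = u₀ i) ∧ (∀ i ∈ R, u i ∈ U i) ∧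
      LinearIndepOn F u ((R₀ ∪ R : Finset ℕ) : Set ℕ) := by
  induction k with
  | zero => exact fun I _ _ => ⟨∅, by simp, rfl, u₀, by simp, by simp, by simpa using h₀⟩
  | succ k ih =>
    intro I hI h
    obtain ⟨a, ha⟩ : (I.filter fun i => k + R₀.card < finrank F (U i)).Nonempty := by
      rw [← Finset.card_pos]
      have := h k (by omega)
      omega
    rw [Finset.mem_filter] at ha
    obtain ⟨R, hRI, hRk, u, hu₀, hu, hli⟩ := ih (I.erase a)
      (hI.mono_right (Finset.erase_subset _ _)) (by
        intro j hj
        have h1 := h j (by omega)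
        rw [Finset.filter_erase]
        have h2 := Finset.pred_card_le_card_erase
          (s := I.filter fun i => j + R₀.card < finrank F (U i)) (a := a)
        omega)
    have haR : a ∉ R := fun h => by simpa using hRI h
    have haR₀ : a ∉ R₀ := fun h => Finset.disjoint_left.1 hI h ha.1
    have hdim : finrank F (span F (u '' ((R₀ ∪ R : Finset ℕ) : Set ℕ))) < finrank F (U a) := by
      classical
      have h1 := finrank_span_finset_le_card (R := F) ((R₀ ∪ R).image u)
      rw [Finset.coe_image] at h1
      have h2 : ((R₀ ∪ R).image u).card ≤ _ := Finset.card_image_le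
      have h3 := Finset.card_union_le R₀ R
      have h4 : finrank F (span F (u '' ((R₀ ∪ R : Finset ℕ) : Set ℕ))) ≤
        ((R₀ ∪ R).image u).card := h1
      omega
    obtain ⟨x, hxU, hx⟩ : ∃ x ∈ U a, x ∉ span F (u '' ((R₀ ∪ R : Finset ℕ) : Set ℕ)) := by
      by_contra! hcon
      exact absurd (Submodule.finrank_mono (show U a ≤ _ from hcon)) (by omega)
    have hne : ∀ i ∈ R₀ ∪ R, Function.update u a x i = u i := by
      intro i hi
      rw [Function.update_of_ne]
      rintro rfl
      simp_all
    refine ⟨insert a R, Finset.insert_subset ha.1 (hRI.trans (Finset.erase_subset _ _)),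
      by rw [Finset.card_insert_of_notMem haR, hRk], Function.update u a x, ?_, ?_, ?_⟩
    · intro i hi
      rw [hne i (by simp [hi]), hu₀ i hi]
    · intro i hi
      rcases Finset.mem_insert.1 hi with rfl | hi
      · simpa using hxU
      · rw [hne i (by simp [hi])]
        exact hu i hi
    · rw [Finset.union_insert, Finset.coe_insert, linearIndepOn_insert (by simp [haR, haR₀])]
      have heq : Set.EqOn u (Function.update u a x) ((R₀ ∪ R : Finset ℕ) : Set ℕ) :=
        fun i hi => (hne i hi).symm
      refine ⟨hli.congr heq, ?_⟩
      rw [← Set.image_congr heq]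
      simpa using hx

/-- If the values of `M ∈ B` at the first vectors of `b` can be completed to an independent family
by elements of the pivot spaces, then some map in `B` has at least the corresponding rank. -/
lemma card_le_of_linearIndepOn [FiniteDimensional F V] {B : Submodule F (V →ₗ[F] E)} {s : ℕ}
    (hB : ∀ A ∈ B, finrank F A.range ≤ s) (b : ℕ → V) (R : Finset ℕ) (u : ℕ → E) (N : ℕ) :
    ∀ (t : ℕ) (M : V →ₗ[F] E), M ∈ B → (∀ i ∈ R, i < t + N) →
    LinearIndepOn F (fun i => if i < t then M (b i) else u i) (R : Set ℕ) →
    (∀ i ∈ R, t ≤ i → u i ∈ pivotSpace B b i) → R.card ≤ s := by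
  induction N with
  | zero =>
    intro t M hM hR hli _
    refine (card_le_finrank_range (b := b) (M := M) ?_).trans (hB M hM)
    exact hli.congr fun i hi => by simp [show i < t by simpa using hR i hi]
  | succ N ih =>
    intro t M hM hR hli hu
    by_cases ht : t ∈ R
    · obtain ⟨A, hAB, hA0, hAt⟩ := mem_pivotSpace.1 (hu t ht le_rfl)
      have hins : (R : Set ℕ) = insert t ((R.erase t : Finset ℕ) : Set ℕ) := by
        rw [← Finset.coe_insert, Finset.insert_erase ht]
      have hnot : t ∉ ((R.erase t : Finset ℕ) : Set ℕ) := by simp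
      rw [hins, linearIndepOn_insert hnot] at hli
      simp only [lt_irrefl, if_false] at hli
      have step : ∀ M' ∈ B, (∀ i < t, M' (b i) = M (b i)) →
          M' (b t) ∉ span F ((fun i => if i < t then M (b i) else u i) ''
            ((R.erase t : Finset ℕ) : Set ℕ)) → R.card ≤ s := by
        intro M' hM' hMM' hnm
        have heq : Set.EqOn (fun i => if i < t then M (b i) else u i)
            (fun i => if i < t + 1 then M' (b i) else u i) ((R.erase t : Finset ℕ) : Set ℕ) := by
          intro i hi
          have hne : i ≠ t := by rintro rfl; exact hnot hi
          by_cases hit : i < t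
          · simp [hit, hMM' i hit, show i < t + 1 by omega]
          · simp [hit, show ¬ i < t + 1 by omega]
        refine ih (t + 1) M' hM' (fun i hi => by have := hR i hi; omega) ?_
          (fun i hi hit => hu i hi (by omega))
        rw [hins, linearIndepOn_insert hnot]
        refine ⟨hli.1.congr heq, ?_⟩
        rw [← Set.image_congr heq]
        simpa using hnm
      by_cases hMt : M (b t) ∈ span F ((fun i => if i < t then M (b i) else u i) ''
            ((R.erase t : Finset ℕ) : Set ℕ))
      · refine step (M + A) (B.add_mem hM hAB) (fun i hi => by simp [hA0 i hi]) fun hcon => hli.2 ?_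
        rw [LinearMap.add_apply, hAt] at hcon
        exact (Submodule.add_mem_iff_right _ hMt).1 hcon
      · exact step M hM (fun _ _ => rfl) hMt
    · refine ih (t + 1) M hM (fun i hi => by have := hR i hi; omega) ?_
        (fun i hi hit => hu i hi (by omega))
      refine hli.congr fun i hi => ?_
      have hne : i ≠ t := by rintro rfl; exact ht hi
      simp only [show i < t + 1 ↔ i < t by omega]

lemma exists_card_pivotSpace_le [FiniteDimensional F V] [FiniteDimensional F E]
    {B : Submodule F (V →ₗ[F] E)} {s : ℕ}
    (hB : ∀ A ∈ B, finrank F A.range ≤ s) (b : ℕ → V) (n : ℕ) :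
    ∃ j ≤ s, ((Finset.range n).filter fun i => j < finrank F (pivotSpace B b i)).card ≤ s - j := by
  by_contra! hcon
  obtain ⟨R, hR, hRs, u, -, hu, hli⟩ := exists_transversal (pivotSpace B b) ∅ 0 (by simp) (s + 1)
    (Finset.range n) (by simp) (fun j hj => by
      have := hcon j (by omega)
      simp only [Finset.card_empty, add_zero]
      omega)
  have := card_le_of_linearIndepOn hB b R u n 0 0 B.zero_mem
    (fun i hi => by simpa using hR hi) (by simpa using hli) (fun i hi _ => hu i hi)
  omega

lemma sum_le_of_card_le
    {n m s j : ℕ} {d : ℕ → ℕ} (hnm : n ≤ m) (hd : ∀ i < n, d i ≤ m)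
    (hj : j ≤ s) (hc : ((Finset.range n).filter fun i => j < d i).card ≤ s - j) :
    ∑ i ∈ Finset.range n, d i ≤ s * m ∧
      (∑ i ∈ Finset.range n, d i = s * m → 0 < m →
        ((∀ i < n, d i = 0 ∨ d i = m) ∧ ((Finset.range n).filter fun i => d i = m).card = s) ∨
        (n = m ∧ ∀ i < n, d i = s)) := by
  set c := ((Finset.range n).filter fun i => j < d i).card with hc_def
  set c' := ((Finset.range n).filter fun i => ¬ j < d i).card with hc'_def
  have hcc : c + c' = n := by
    rw [hc_def, hc'_def, Finset.card_filter_add_card_filter_not, Finset.card_range]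
  have hle : ∀ i ∈ Finset.range n, d i ≤ if j < d i then m else j := by
    intro i hi
    split_ifs with h
    · exact hd i (by simpa using hi)
    · omega
  have hsum : ∑ i ∈ Finset.range n, (if j < d i then m else j) = c * m + c' * j := by
    rw [Finset.sum_ite]
    simp [hc_def, hc'_def]
  have h1 := Finset.sum_le_sum hle
  rw [hsum] at h1
  have h2 : c' * j ≤ m * j := Nat.mul_le_mul_right _ (by omega)
  have h3 : (c + j) * m ≤ s * m := Nat.mul_le_mul_right _ (by omega)
  have h4 : c * m + m * j = (c + j) * m := by ring
  refine ⟨by omega, fun heq hm => ?_⟩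
  have hterm : ∀ i ∈ Finset.range n, d i = if j < d i then m else j :=
    (Finset.sum_eq_sum_iff_of_le hle).1 (by omega)
  have hcs : c + j = s := Nat.eq_of_mul_eq_mul_right hm (by omega)
  have hcm : c' * j = m * j := by omega
  rcases Nat.eq_zero_or_pos j with rfl | hj0
  · left
    have hterm' : ∀ i < n, d i = 0 ∨ d i = m := by
      intro i hi
      have := hterm i (by simpa using hi)
      split_ifs at this <;> omega
    refine ⟨hterm', ?_⟩
    rw [← hcs, add_zero, hc_def]
    congr 1
    refine Finset.filter_congr fun i hi => ?_
    have := hterm' i (by simpa using hi)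
    omega
  · right
    have hc'm : c' = m := Nat.eq_of_mul_eq_mul_right hj0 hcm
    refine ⟨by omega, fun i hi => ?_⟩
    have h0 : c = 0 := by omega
    rw [hc_def, Finset.card_eq_zero, Finset.filter_eq_empty_iff] at h0
    have h5 := h0 (by simpa using hi : i ∈ Finset.range n)
    have h6 := hterm i (by simpa using hi)
    rw [if_neg h5] at h6
    omega

lemma exists_flag [FiniteDimensional F V] (c : ℕ → V) (k : ℕ) (hc : LinearIndepOn F c (Set.Iio k)) :
    ∃ b : ℕ → V, (∀ i < k, b i = c i) ∧ span F (b '' Set.Iio (finrank F V)) = ⊤ := by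
  have hk : k ≤ finrank F V := by
    simpa using LinearIndependent.fintype_card_le_finrank hc
  obtain ⟨R, hR, hRk, u, hu₀, -, hu⟩ := exists_transversal (fun _ => (⊤ : Submodule F V))
    (Finset.range k) c (by simpa using hc) (finrank F V - k) (Finset.Ico k (finrank F V))
    (Finset.disjoint_left.2 fun a ha => by simp at ha ⊢; omega) (fun j hj => by
      rw [Finset.filter_true_of_mem]
      · simp
      · intro i hi
        simp
        omega)
  have hRI := Finset.eq_of_subset_of_card_le hR (by simp [hRk])
  have hset : ((Finset.range k ∪ R : Finset ℕ) : Set ℕ) = Set.Iio (finrank F V) := by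
    ext i
    simp [hRI]
    omega
  rw [hset] at hu
  refine ⟨u, by simpa using hu₀, ?_⟩
  rw [Set.image_eq_range]
  exact LinearIndependent.span_eq_top_of_card_eq_finrank' hu (by simp)

lemma finrank_span_prefix_le [FiniteDimensional F V] [FiniteDimensional F E]
    {B : Submodule F (V →ₗ[F] E)} {s n l : ℕ}
    (hB : ∀ A ∈ B, finrank F A.range ≤ s) (hs : s < finrank F E) (b : ℕ → V)
    (hcard : ((Finset.range n).filter fun i =>
      finrank F (pivotSpace B b i) = finrank F E).card = s)
    (hln : l < n) (hlt : ∀ i < l, pivotSpace B b i = ⊤) (hl : pivotSpace B b l = ⊥)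
    {M : V →ₗ[F] E} (hM : M ∈ B) :
    finrank F (span F ((fun i => M (b i)) '' Set.Iio (l + 1))) ≤ l := by
  by_contra! hcon
  have hli : LinearIndepOn F (fun i => M (b i)) (Set.Iio (l + 1)) := by
    rw [LinearIndepOn, linearIndependent_iff_card_le_finrank_span, Set.finrank]
    rw [Set.image_eq_range] at hcon
    simpa using hcon
  set I := (Finset.Ioo l n).filter fun i => finrank F (pivotSpace B b i) = finrank F E with hI
  have hcount : s = l + I.card := by
    rw [← hcard, ← Finset.card_range l, ← Finset.card_union_of_disjoint]
    · congr 1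
      ext i
      simp only [hI, Finset.mem_filter, Finset.mem_range, Finset.mem_union, Finset.mem_Ioo]
      constructor
      · rintro ⟨h1, h2⟩
        by_cases h3 : i < l
        · exact Or.inl h3
        · refine Or.inr ⟨⟨lt_of_le_of_ne (not_lt.1 h3) ?_, h1⟩, h2⟩
          rintro rfl
          rw [hl, finrank_bot] at h2
          omega
      · rintro (h | ⟨⟨h1, h2⟩, h3⟩)
        · refine ⟨h.trans hln, ?_⟩
          rw [hlt i h, finrank_top]
        · exact ⟨h2, h3⟩
    · refine Finset.disjoint_left.2 fun a ha => ?_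
      simp only [hI, Finset.mem_filter, Finset.mem_range, Finset.mem_Ioo] at ha ⊢
      omega
  obtain ⟨R, hRI, hRk, u, hu₀, hu, huli⟩ := exists_transversal (pivotSpace B b)
    (Finset.range (l + 1)) (fun i => M (b i)) (by simpa using hli) I.card I
    (Finset.disjoint_left.2 fun a ha => by
      simp only [hI, Finset.mem_filter, Finset.mem_range, Finset.mem_Ioo] at ha ⊢; omega)
    (fun j hj => by
      rw [Finset.filter_true_of_mem]
      · omega
      · intro i hi
        rw [(Finset.mem_filter.1 hi).2, Finset.card_range]
        omega)
  have hRI' : ∀ i ∈ R, l < i ∧ i < n := fun i hi => by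
    have := hRI hi
    simp only [hI, Finset.mem_filter, Finset.mem_Ioo] at this
    exact this.1
  have := card_le_of_linearIndepOn hB b (Finset.range (l + 1) ∪ R) u n (l + 1) M hM
    (fun i hi => by
      rcases Finset.mem_union.1 hi with hi | hi
      · have := Finset.mem_range.1 hi
        omega
      · have := hRI' i hi
        omega)
    (huli.congr fun i hi => by
      rcases Finset.mem_union.1 (Finset.mem_coe.1 hi) with hi | hi
      · rw [hu₀ i hi]
        simp [Finset.mem_range.1 hi]
      · have := hRI' i hi
        simp [show ¬ i < l + 1 by omega])
    (fun i hi hli => by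
      rcases Finset.mem_union.1 hi with hi | hi
      · have := Finset.mem_range.1 hi
        omega
      · exact hu i hi)
  rw [Finset.card_union_of_disjoint, Finset.card_range, hRk] at this
  · omega
  · refine Finset.disjoint_left.2 fun a ha ha' => ?_
    have := hRI' a ha'
    have := Finset.mem_range.1 ha
    omega

lemma exists_mem_forall_apply_eq {B : Submodule F (V →ₗ[F] E)} {b : ℕ → V} {l : ℕ}
    (hlt : ∀ i < l, pivotSpace B b i = ⊤) (z : ℕ → E) : ∃ M ∈ B, ∀ i < l, M (b i) = z i := by
  induction l with
  | zero => exact ⟨0, B.zero_mem, by simp⟩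
  | succ l ih =>
    obtain ⟨M, hM, hMz⟩ := ih fun i hi => hlt i (by omega)
    have hmem : z l - M (b l) ∈ pivotSpace B b l := by simp [hlt l (by omega)]
    obtain ⟨A, hA, hA0, hAl⟩ := mem_pivotSpace.1 hmem
    refine ⟨M + A, B.add_mem hM hA, fun i hi => ?_⟩
    rcases Nat.lt_succ_iff_lt_or_eq.1 hi with hi | rfl
    · simp [hMz i hi, hA0 i hi]
    · simp [hAl]

/-- If the pivot spaces before `l + 1` are full and the pivot space at `l + 1` vanishes, then the
maps in `B` vanishing on `b 0, …, b (l - 1)` have collinear values at `b l` and `b (l + 1)`. -/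
lemma apply_mem_span_singleton [FiniteDimensional F V] [FiniteDimensional F E]
    {B : Submodule F (V →ₗ[F] E)} {s n l : ℕ}
    (hB : ∀ A ∈ B, finrank F A.range ≤ s) (hs : s < finrank F E) (b : ℕ → V)
    (hcard : ((Finset.range n).filter fun i =>
      finrank F (pivotSpace B b i) = finrank F E).card = s)
    (hln : l + 1 < n) (hlE : l + 1 < finrank F E) (hlt : ∀ i < l + 1, pivotSpace B b i = ⊤)
    (hl : pivotSpace B b (l + 1) = ⊥) {A : V →ₗ[F] E} (hA : A ∈ vanishing B b l) :
    ¬ LinearIndependent F ![A (b l), A (b (l + 1))] := by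
  intro hind
  obtain ⟨hAB, hA0⟩ := hA
  have hu₀ : LinearIndepOn F (fun i => if i = 0 then A (b l) else A (b (l + 1)))
      (({0, l + 1} : Finset ℕ) : Set ℕ) := by
    rw [Finset.coe_pair, LinearIndepOn.pair_iff _ (by omega)]
    rw [LinearIndependent.pair_iff] at hind
    simpa using hind
  obtain ⟨R, hRI, hRk, z, hz₀, -, hz⟩ := exists_transversal (fun _ => (⊤ : Submodule F E))
    {0, l + 1} _ hu₀ l (Finset.Ioo 0 (l + 1)) (Finset.disjoint_left.2 fun a ha => by
      simp only [Finset.mem_insert, Finset.mem_singleton, Finset.mem_Ioo] at ha ⊢; omega)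
    (fun j hj => by
      rw [Finset.filter_true_of_mem]
      · simp
      · intro i hi
        rw [Finset.card_pair (by omega), finrank_top]
        omega)
  have hRI' := Finset.eq_of_subset_of_card_le hRI (by simp [hRk])
  have hset : (({0, l + 1} ∪ R : Finset ℕ) : Set ℕ) = insert (l + 1) (Set.Iio (l + 1)) := by
    ext i
    simp [hRI']
  have hz0 : z 0 = A (b l) := by simpa using hz₀ 0 (by simp)
  have hzl : z (l + 1) = A (b (l + 1)) := by simpa using hz₀ (l + 1) (by simp)
  rw [hset, linearIndepOn_insert (by simp)] at hz
  obtain ⟨hzli, hznot⟩ := hz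
  set Z := span F (z '' Set.Iio (l + 1)) with hZ
  have hZdim : finrank F Z = l + 1 := by
    rw [hZ, Set.image_eq_range]
    simpa using finrank_span_eq_card hzli
  have hmem : ∀ M ∈ B, (∀ i < l + 1, z i ∈ span F ((fun i => M (b i)) '' Set.Iio (l + 1))) →
      M (b (l + 1)) ∈ Z := by
    intro M hM hMz
    have h1 := finrank_span_prefix_le hB hs b hcard hln hlt hl hM
    have h2 : Z ≤ span F ((fun i => M (b i)) '' Set.Iio (l + 1 + 1)) := by
      rw [hZ, span_le]
      rintro _ ⟨i, hi, rfl⟩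
      exact span_mono (Set.image_mono (Set.Iio_subset_Iio (by omega))) (hMz i hi)
    rw [Submodule.eq_of_le_of_finrank_le h2 (by omega)]
    exact subset_span ⟨l + 1, by simp, rfl⟩
  rcases Nat.eq_zero_or_pos l with rfl | hl0
  · apply hznot
    rw [hzl]
    refine hmem A hAB fun i hi => ?_
    obtain rfl : i = 0 := by omega
    rw [hz0]
    exact subset_span ⟨0, by simp, rfl⟩
  · obtain ⟨M, hM, hMz⟩ := exists_mem_forall_apply_eq hlt z
    have h1 := hmem M hM fun i hi => by
      rw [← hMz i hi]
      exact subset_span ⟨i, by simpa using hi, rfl⟩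
    have hlt' : ∀ i < l, z i ∈ span F ((fun i => (M + A) (b i)) '' Set.Iio (l + 1)) := by
      intro i hi
      have : z i = (M + A) (b i) := by simp [hMz i (by omega), hA0 i hi]
      rw [this]
      exact subset_span ⟨i, by simp; omega, rfl⟩
    have h2 := hmem (M + A) (B.add_mem hM hAB) fun i hi => by
      rcases Nat.lt_succ_iff_lt_or_eq.1 hi with hi | rfl
      · exact hlt' i hi
      · have : z i = (M + A) (b i) - z 0 := by simp [hMz i (by omega), hz0]
        rw [this]
        exact sub_mem (subset_span ⟨i, by simp, rfl⟩) (hlt' 0 hl0)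
    apply hznot
    rw [hzl]
    rw [LinearMap.add_apply] at h2
    exact (Submodule.add_mem_iff_right _ h1).1 h2

lemma exists_apply_eq_smul [FiniteDimensional F V] [FiniteDimensional F E]
    {B : Submodule F (V →ₗ[F] E)} {s n l : ℕ}
    (hB : ∀ A ∈ B, finrank F A.range ≤ s) (hs : s < finrank F E) (b : ℕ → V)
    (hcard : ((Finset.range n).filter fun i =>
      finrank F (pivotSpace B b i) = finrank F E).card = s)
    (hln : l + 1 < n) (hlE : l + 1 < finrank F E) (hlt : ∀ i < l + 1, pivotSpace B b i = ⊤)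
    (hl : pivotSpace B b (l + 1) = ⊥) :
    ∃ c : F, ∀ A ∈ vanishing B b l, A (b (l + 1)) = c • A (b l) := by
  have hker : ∀ A ∈ vanishing B b l, A (b l) = 0 → A (b (l + 1)) = 0 := by
    intro A hA hAl
    have : A (b (l + 1)) ∈ pivotSpace B b (l + 1) := by
      refine mem_pivotSpace.2 ⟨A, hA.1, fun j hj => ?_, rfl⟩
      rcases Nat.lt_succ_iff_lt_or_eq.1 hj with hj | rfl
      · exact hA.2 j hj
      · exact hAl
    simpa [hl] using this
  set f : vanishing B b l →ₗ[F] E :=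
    (LinearMap.applyₗ (b l) : (V →ₗ[F] E) →ₗ[F] E).domRestrict _ with hf
  set g : vanishing B b l →ₗ[F] E :=
    (LinearMap.applyₗ (b (l + 1)) : (V →ₗ[F] E) →ₗ[F] E).domRestrict _ with hg
  have hfr : f.range = ⊤ := by
    rw [hf, LinearMap.range_domRestrict]
    exact hlt l (by omega)
  obtain ⟨h, hh⟩ := f.exists_rightInverse_of_surjective hfr
  have hfh : ∀ x, f (h x) = x := fun x => LinearMap.congr_fun hh x
  obtain ⟨c, hc⟩ := LinearMap.exists_eq_smul_id_of_forall_notLinearIndependent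
    (f := g ∘ₗ h) fun x => by
      have := apply_mem_span_singleton hB hs b hcard hln hlE hlt hl (h x).2
      rwa [show (h x : V →ₗ[F] E) (b l) = x from hfh x] at this
  refine ⟨c, fun A hA => ?_⟩
  have h1 := hker _ (sub_mem hA (h (A (b l))).2) (by
    rw [LinearMap.sub_apply, sub_eq_zero]
    exact (hfh _).symm)
  rw [LinearMap.sub_apply, sub_eq_zero] at h1
  rw [h1]
  exact LinearMap.congr_fun hc (A (b l))

/-- The vectors killed by all maps in `B`. -/
def commonKer (B : Submodule F (V →ₗ[F] E)) : Submodule F V := ⨅ A ∈ B, A.ker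

lemma mem_commonKer {B : Submodule F (V →ₗ[F] E)} {v : V} :
    v ∈ commonKer B ↔ ∀ A ∈ B, A v = 0 := by
  simp [commonKer, Submodule.mem_iInf]

lemma linearIndepOn_update {b : ℕ → V} {l : ℕ} (hb : LinearIndepOn F b (Set.Iio l)) {v : V}
    (hv : v ∉ span F (b '' Set.Iio l)) :
    LinearIndepOn F (Function.update b l v) (Set.Iio (l + 1)) := by
  have hset : Set.Iio (l + 1) = insert l (Set.Iio l) := by ext i; simp
  have heq : Set.EqOn b (Function.update b l v) (Set.Iio l) := fun i hi => by
    rw [Function.update_of_ne (ne_of_lt hi)]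
  rw [hset, linearIndepOn_insert (by simp), ← Set.image_congr heq]
  exact ⟨hb.congr heq, by simpa using hv⟩

lemma le_finrank_of_linearIndepOn [FiniteDimensional F V]
    {b : ℕ → V} {l : ℕ} (hb : LinearIndepOn F b (Set.Iio l)) :
    l ≤ finrank F V := by
  simpa using LinearIndependent.fintype_card_le_finrank hb

lemma exists_mem_commonKer [FiniteDimensional F V] [FiniteDimensional F E]
    {B : Submodule F (V →ₗ[F] E)} {s : ℕ}
    (hB : ∀ A ∈ B, finrank F A.range ≤ s) (hs : s < finrank F E)
    (hVE : finrank F V ≤ finrank F E)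
    (hcard : ∀ b : ℕ → V, span F (b '' Set.Iio (finrank F V)) = ⊤ →
      ((Finset.range (finrank F V)).filter fun i =>
        finrank F (pivotSpace B b i) = finrank F E).card = s)
    (b : ℕ → V) (l : ℕ) : LinearIndepOn F b (Set.Iio l) → (∀ i < l, pivotSpace B b i = ⊤) →
    ∀ v ∉ span F (b '' Set.Iio l), (∀ A ∈ vanishing B b l, A v = 0) →
    ∃ v' ∈ commonKer B, v - v' ∈ span F (b '' Set.Iio l) := by
  induction l with
  | zero => exact fun _ _ v _ h => ⟨v, mem_commonKer.2 fun A hA => h A ⟨hA, by simp⟩, by simp⟩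
  | succ l ih =>
    intro hb hlt v hv hvan
    have hc := linearIndepOn_update hb hv
    obtain ⟨b', hb', hspan⟩ := exists_flag _ _ hc
    have hbb : ∀ i < l + 1, b' i = b i := fun i hi => by
      rw [hb' i (by omega), Function.update_of_ne (by omega)]
    have hbv : b' (l + 1) = v := by rw [hb' _ (by omega), Function.update_self]
    have hn := le_finrank_of_linearIndepOn hc
    obtain ⟨c, hc⟩ := exists_apply_eq_smul hB hs b' (hcard b' hspan) (l := l) (by omega) (by omega)
      (fun i hi => by
        rw [pivotSpace_congr (c := b) fun j hj => hbb j (by omega)]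
        exact hlt i hi)
      (by
        rw [eq_bot_iff]
        intro x hx
        obtain ⟨A, hA, hA0, rfl⟩ := mem_pivotSpace.1 hx
        rw [hbv]
        exact hvan A ⟨hA, fun j hj => by rw [← hbb j hj]; exact hA0 j hj⟩)
    rw [hbv, hbb l (by omega)] at hc
    have hmono : span F (b '' Set.Iio l) ≤ span F (b '' Set.Iio (l + 1)) :=
      span_mono (Set.image_mono (Set.Iio_subset_Iio (by omega)))
    have hbl : c • b l ∈ span F (b '' Set.Iio (l + 1)) :=
      Submodule.smul_mem _ _ (subset_span ⟨l, by simp, rfl⟩)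
    obtain ⟨v', hv', hvv'⟩ := ih (hb.mono (Set.Iio_subset_Iio (by omega)))
      (fun i hi => hlt i (by omega)) (v - c • b l)
      (fun h => hv ((Submodule.sub_mem_iff_left _ hbl).1 (hmono h)))
      (fun A hA => by
        have : A ∈ vanishing B b' l :=
          ⟨hA.1, fun j hj => by rw [hbb j (by omega)]; exact hA.2 j hj⟩
        simp [hc A this])
    refine ⟨v', hv', ?_⟩
    have := add_mem (hmono hvv') hbl
    rwa [show v - c • b l - v' + c • b l = v - v' by abel] at this

lemma finrank_le_finrank_commonKer_add [FiniteDimensional F V] [FiniteDimensional F E]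
    {B : Submodule F (V →ₗ[F] E)} {s : ℕ}
    (hB : ∀ A ∈ B, finrank F A.range ≤ s) (hs : s < finrank F E)
    (hVE : finrank F V ≤ finrank F E)
    (hpiv : ∀ b : ℕ → V, span F (b '' Set.Iio (finrank F V)) = ⊤ →
      (∀ i < finrank F V, finrank F (pivotSpace B b i) = 0 ∨
        finrank F (pivotSpace B b i) = finrank F E) ∧
      ((Finset.range (finrank F V)).filter fun i =>
        finrank F (pivotSpace B b i) = finrank F E).card = s) :
    finrank F V ≤ finrank F (commonKer B) + s := by
  by_contra! hcon
  have hks : ∀ k b, LinearIndepOn F b (Set.Iio k) → (∀ i < k, pivotSpace B b i = ⊤) → k ≤ s := by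
    intro k b hb hlt
    obtain ⟨b', hb', hspan⟩ := exists_flag b k hb
    have hk := le_finrank_of_linearIndepOn hb
    rw [← (hpiv b' hspan).2]
    conv_lhs => rw [← Finset.card_range k]
    refine Finset.card_le_card fun i hi => ?_
    have hik := Finset.mem_range.1 hi
    rw [Finset.mem_filter, Finset.mem_range, pivotSpace_congr fun j hj => hb' j (by omega),
      hlt i hik, finrank_top]
    exact ⟨by omega, rfl⟩
  have hex : ∀ k, ∃ b : ℕ → V, LinearIndepOn F b (Set.Iio k) ∧ ∀ i < k, pivotSpace B b i = ⊤ := by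
    intro k
    induction k with
    | zero => exact ⟨0, by simp, by simp⟩
    | succ k ih =>
      obtain ⟨b, hb, hlt⟩ := ih
      have hk := hks k b hb hlt
      have hdim : finrank F (commonKer B ⊔ span F (b '' Set.Iio k) : Submodule F V) <
          finrank F V := by
        have h1 := Submodule.finrank_add_le_finrank_add_finrank (commonKer B)
          (span F (b '' Set.Iio k))
        have h2 : finrank F (span F (b '' Set.Iio k)) = k := by
          rw [Set.image_eq_range]
          simpa using finrank_span_eq_card hb
        omega
      obtain ⟨v, hv⟩ : ∃ v, v ∉ commonKer B ⊔ span F (b '' Set.Iio k) := by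
        by_contra! h
        rw [Submodule.eq_top_iff'.2 h, finrank_top] at hdim
        omega
      have hvb : v ∉ span F (b '' Set.Iio k) := fun h => hv (mem_sup_right h)
      have hc := linearIndepOn_update hb hvb
      refine ⟨_, hc, fun i hi => ?_⟩
      have hcb : ∀ j < k, Function.update b k v j = b j := fun j hj => by
        rw [Function.update_of_ne (by omega)]
      rcases Nat.lt_succ_iff_lt_or_eq.1 hi with hi | rfl
      · rw [pivotSpace_congr (c := b) fun j hj => hcb j (by omega)]
        exact hlt i hi
      · obtain ⟨b', hb', hspan⟩ := exists_flag _ _ hc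
        have hi := le_finrank_of_linearIndepOn hc
        have hor := (hpiv b' hspan).1 i (by omega)
        rw [pivotSpace_congr fun j hj => hb' j (by omega)] at hor
        rcases hor with h0 | h
        · exfalso
          obtain ⟨v', hv', hvv'⟩ := exists_mem_commonKer hB hs hVE (fun b hb => (hpiv b hb).2)
            b i hb hlt v hvb fun A hA => by
              have : A v ∈ pivotSpace B (Function.update b i v) i :=
                mem_pivotSpace.2 ⟨A, hA.1, fun j hj => by rw [hcb j hj]; exact hA.2 j hj,
                  by rw [Function.update_self]⟩
              rw [Submodule.finrank_eq_zero.1 h0] at this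
              simpa using this
          apply hv
          have := add_mem (mem_sup_left hv' : v' ∈ commonKer B ⊔ span F (b '' Set.Iio i))
            (mem_sup_right hvv')
          simpa using this
        · exact Submodule.eq_top_of_finrank_eq h
  obtain ⟨b, hb, hlt⟩ := hex (s + 1)
  have := hks _ b hb hlt
  omega

lemma pivotSpace_zero_le_one [FiniteDimensional F V] [FiniteDimensional F E]
    {B : Submodule F (V →ₗ[F] E)} {s n : ℕ}
    (hB : ∀ A ∈ B, finrank F A.range ≤ s) (b : ℕ → V) (hs : 0 < s) (hsn : s < n)
    (hd : ∀ i < n, finrank F (pivotSpace B b i) = s) : pivotSpace B b 0 ≤ pivotSpace B b 1 := by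
  intro x hx0
  by_contra hx1
  have hx : x ≠ 0 := by
    rintro rfl
    exact hx1 (zero_mem _)
  obtain ⟨R, hRI, hRk, u, hu₀, hu, hli⟩ := exists_transversal (pivotSpace B b) {0} (fun _ => x)
    (by simpa using hx) (s - 1) (Finset.Ico 2 n) (by simp) (fun j hj => by
      rw [Finset.filter_true_of_mem]
      · simp
        omega
      · intro i hi
        rw [hd i (by simp at hi; omega), Finset.card_singleton]
        omega)
  have hu0 : u 0 = x := hu₀ 0 (by simp)
  have hRI' : ∀ i ∈ R, 2 ≤ i ∧ i < n := fun i hi => by simpa using hRI hi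
  have h0R : 0 ∉ R := fun h => by have := hRI' 0 h; omega
  have h1R : 1 ∉ R := fun h => by have := hRI' 1 h; omega
  have hcard : ({0} ∪ R : Finset ℕ).card = s := by
    rw [Finset.card_union_of_disjoint (by simpa using h0R), hRk, Finset.card_singleton]
    omega
  have hdim : finrank F (span F (u '' (({0} ∪ R : Finset ℕ) : Set ℕ))) = s := by
    have := finrank_span_eq_card hli
    rw [Set.image_eq_range]
    simpa [← hcard] using this
  obtain ⟨y, hy1, hy⟩ : ∃ y ∈ pivotSpace B b 1,
      y ∉ span F (u '' (({0} ∪ R : Finset ℕ) : Set ℕ)) := by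
    by_contra! hcon
    have := Submodule.eq_of_le_of_finrank_eq (show pivotSpace B b 1 ≤ _ from hcon)
      (by rw [hdim, hd 1 (by omega)])
    apply hx1
    rw [this]
    exact subset_span ⟨0, by simp, hu0⟩
  have hne : ∀ i ∈ ({0} ∪ R : Finset ℕ), Function.update u 1 y i = u i := by
    intro i hi
    rw [Function.update_of_ne]
    rintro rfl
    simp [h1R] at hi
  have heq : Set.EqOn u (Function.update u 1 y) (({0} ∪ R : Finset ℕ) : Set ℕ) :=
    fun i hi => (hne i hi).symm
  have h1 : 1 ∉ ({0} ∪ R : Finset ℕ) := by simp [h1R]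
  have := card_le_of_linearIndepOn hB b (insert 1 ({0} ∪ R)) (Function.update u 1 y) n 0 0
    B.zero_mem (fun i hi => by
      simp only [Finset.mem_insert, Finset.mem_union, Finset.mem_singleton] at hi
      rcases hi with rfl | rfl | hi
      · omega
      · omega
      · have := hRI' i hi
        omega)
    (by
      simp only [not_lt_zero, if_false]
      rw [Finset.coe_insert, linearIndepOn_insert (by simpa using h1)]
      refine ⟨hli.congr heq, ?_⟩
      rw [← Set.image_congr heq]
      simpa using hy)
    (fun i hi _ => by
      rcases Finset.mem_insert.1 hi with rfl | hi
      · simpa using hy1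
      · rw [hne i hi]
        rcases Finset.mem_union.1 hi with hi | hi
        · rw [Finset.mem_singleton.1 hi, hu0]
          exact hx0
        · exact hu i hi)
  rw [Finset.card_insert_of_notMem h1, hcard] at this
  omega

lemma finrank_le_mul [FiniteDimensional F V] [FiniteDimensional F E]
    {B : Submodule F (V →ₗ[F] E)} {s : ℕ}
    (hB : ∀ A ∈ B, finrank F A.range ≤ s) (hVE : finrank F V ≤ finrank F E) :
    finrank F B ≤ s * finrank F E := by
  obtain ⟨b, -, hspan⟩ := exists_flag (F := F) (0 : ℕ → V) 0 (by simp)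
  obtain ⟨j, hj, hc⟩ := exists_card_pivotSpace_le hB b (finrank F V)
  rw [finrank_eq_sum B b _ hspan]
  exact (sum_le_of_card_le hVE (fun i _ => Submodule.finrank_le _) hj hc).1

/-- Classification of the spaces of linear maps of rank at most `s` of maximal dimension. -/
theorem exists_le_ker_or_range_le [FiniteDimensional F V] [FiniteDimensional F E]
    {B : Submodule F (V →ₗ[F] E)} {s : ℕ}
    (hB : ∀ A ∈ B, finrank F A.range ≤ s) (hVE : finrank F V ≤ finrank F E)
    (hdim : finrank F B = s * finrank F E) :
    (∃ K : Submodule F V, finrank F V ≤ finrank F K + s ∧ ∀ A ∈ B, K ≤ A.ker) ∨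
    (finrank F V = finrank F E ∧ ∃ U : Submodule F E, finrank F U ≤ s ∧ ∀ A ∈ B, A.range ≤ U) := by
  rcases Nat.lt_or_ge s (finrank F V) with hsn | hsn
  swap
  · exact Or.inl ⟨⊥, by omega, by simp⟩
  rcases Nat.eq_zero_or_pos s with rfl | hs
  · refine Or.inl ⟨⊤, by simp, fun A hA => ?_⟩
    have := hB A hA
    rw [Nat.le_zero, Submodule.finrank_eq_zero, LinearMap.range_eq_bot] at this
    simp [this]
  have hflag : ∀ b : ℕ → V, span F (b '' Set.Iio (finrank F V)) = ⊤ →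
      ((∀ i < finrank F V, finrank F (pivotSpace B b i) = 0 ∨
        finrank F (pivotSpace B b i) = finrank F E) ∧
      ((Finset.range (finrank F V)).filter fun i =>
        finrank F (pivotSpace B b i) = finrank F E).card = s) ∨
      (finrank F V = finrank F E ∧ ∀ i < finrank F V, finrank F (pivotSpace B b i) = s) := by
    intro b hb
    obtain ⟨j, hj, hc⟩ := exists_card_pivotSpace_le hB b (finrank F V)
    exact (sum_le_of_card_le hVE (fun i _ => Submodule.finrank_le _) hj hc).2
      (by rw [← finrank_eq_sum B b _ hb, hdim]) (by omega)
  set ev : V → (V →ₗ[F] E) →ₗ[F] E := fun w => LinearMap.applyₗ w with hev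
  by_cases hw : ∃ w : V, finrank F (B.map (ev w)) ≠ 0 ∧ finrank F (B.map (ev w)) ≠ finrank F E
  · right
    obtain ⟨w, hw0, hwE⟩ := hw
    have hwE' := (Submodule.finrank_le (B.map (ev w))).lt_of_ne hwE
    have hwne : w ≠ 0 := by
      rintro rfl
      apply hw0
      rw [Submodule.finrank_eq_zero, eq_bot_iff]
      rintro _ ⟨A, -, rfl⟩
      simp [hev]
    have hdimw : finrank F V = finrank F E ∧ finrank F (B.map (ev w)) = s := by
      obtain ⟨b, hb, hspan⟩ := exists_flag (F := F) (fun _ => w) 1 (by simpa using hwne)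
      have hb0 : pivotSpace B b 0 = B.map (ev w) := by
        rw [pivotSpace_zero, hb 0 (by omega)]
      rcases hflag b hspan with ⟨h, -⟩ | ⟨h, h'⟩
      · have := h 0 (by omega)
        rw [hb0] at this
        omega
      · exact ⟨h, by rw [← hb0]; exact h' 0 (by omega)⟩
    refine ⟨hdimw.1, B.map (ev w), hdimw.2.le, ?_⟩
    rintro A hA _ ⟨w', rfl⟩
    by_cases hspanw : w' ∈ span F {w}
    · obtain ⟨c, rfl⟩ := mem_span_singleton.1 hspanw
      rw [map_smul]
      exact Submodule.smul_mem _ _ ⟨A, hA, rfl⟩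
    have hli : LinearIndepOn F (fun i => if i = 0 then w' else w) (Set.Iio 2) := by
      have : Set.Iio 2 = {0, 1} := by ext i; simp; omega
      rw [this, linearIndepOn_insert (by simp)]
      simpa using ⟨hwne, hspanw⟩
    obtain ⟨b, hb, hspan⟩ := exists_flag _ 2 hli
    have hb0 : b 0 = w' := by simpa using hb 0
    have hb1 : b 1 = w := by simpa using hb 1
    have h2 := le_finrank_of_linearIndepOn hli
    have hle1 : pivotSpace B b 1 ≤ B.map (ev w) := by
      have := pivotSpace_le_map B b 1
      rwa [hb1] at this
    rcases hflag b hspan with ⟨h, hcard⟩ | ⟨-, h⟩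
    · exfalso
      have hd1 : pivotSpace B b 1 = ⊥ := by
        rw [← Submodule.finrank_eq_zero]
        have := h 1 (by omega)
        have := Submodule.finrank_mono hle1
        omega
      rcases h 0 (by omega) with h0 | h0
      · have : B.map (ev w) ≤ pivotSpace B b 1 := by
          rintro _ ⟨A, hA, rfl⟩
          refine mem_pivotSpace.2 ⟨A, hA, fun j hj => ?_, by rw [hb1]; rfl⟩
          obtain rfl : j = 0 := by omega
          have : A (b 0) ∈ pivotSpace B b 0 := mem_pivotSpace.2 ⟨A, hA, by simp, rfl⟩
          rw [Submodule.finrank_eq_zero.1 h0] at this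
          simpa using this
        rw [hd1, le_bot_iff, ← Submodule.finrank_eq_zero] at this
        exact hw0 this
      · have h0' : pivotSpace B b 0 = ⊤ := Submodule.eq_top_of_finrank_eq h0
        obtain ⟨c, hc⟩ := exists_apply_eq_smul hB (by omega) b hcard (l := 0) (by omega) (by omega)
          (fun i hi => by
            obtain rfl : i = 0 := by omega
            exact h0') hd1
        have hc' : ∀ A ∈ B, A w = c • A w' := fun A hA => by
          have := hc A ⟨hA, by simp⟩
          rwa [zero_add, hb0, hb1] at this
        rw [pivotSpace_zero, hb0] at h0'
        rcases eq_or_ne c 0 with rfl | hc0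
        · apply hw0
          rw [Submodule.finrank_eq_zero, eq_bot_iff]
          rintro _ ⟨A, hA, rfl⟩
          simp [hev, hc' A hA]
        · apply hwE
          suffices htop : B.map (ev w) = ⊤ by rw [htop, finrank_top]
          rw [eq_top_iff]
          intro x _
          have hx : c⁻¹ • x ∈ B.map (LinearMap.applyₗ w') := by simp [h0']
          obtain ⟨A, hA, hAx⟩ := hx
          refine ⟨A, hA, ?_⟩
          change A w = x
          rw [hc' A hA, show A w' = c⁻¹ • x from hAx, smul_inv_smul₀ hc0]
    · refine hle1 (pivotSpace_zero_le_one hB b hs hsn h ?_)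
      rw [pivotSpace_zero, hb0]
      exact ⟨A, hA, rfl⟩
  · left
    push Not at hw
    refine ⟨commonKer B, ?_, fun A hA v hv => mem_commonKer.1 hv A hA⟩
    refine finrank_le_finrank_commonKer_add hB (by omega) hVE fun b hb => ?_
    refine (hflag b hb).resolve_right ?_
    rintro ⟨-, h⟩
    have h0 := h 0 (by omega)
    rw [pivotSpace_zero] at h0
    change finrank F (B.map (ev (b 0))) = s at h0
    have := hw (b 0) (by omega)
    omega

lemma exists_finrank_eq_between [FiniteDimensional F V] {K U : Submodule F V} (hKU : K ≤ U) {d : ℕ}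
    (hK : finrank F K ≤ d) (hU : d ≤ finrank F U) :
    ∃ W, K ≤ W ∧ W ≤ U ∧ finrank F W = d := by
  induction d, hK using Nat.le_induction with
  | base => exact ⟨K, le_rfl, hKU, rfl⟩
  | succ d _ ih =>
    obtain ⟨W, hKW, hWU, hW⟩ := ih (by omega)
    obtain ⟨v, hvU, hvW⟩ : ∃ v ∈ U, v ∉ W := by
      by_contra! h
      have := Submodule.finrank_mono (R := F) (show U ≤ W from h)
      omega
    exact ⟨W ⊔ F ∙ v, hKW.trans le_sup_left,
      sup_le hWU ((span_singleton_le_iff_mem v U).2 hvU),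
      by rw [finrank_sup_span_singleton hvW, hW]⟩

lemma mem_range_lcomp_mkQ {K : Submodule F V} {A : V →ₗ[F] E} :
    A ∈ (LinearMap.lcomp F E K.mkQ).range ↔ K ≤ A.ker := by
  constructor
  · rintro ⟨g, rfl⟩ v hv
    simp [(Submodule.Quotient.mk_eq_zero K).2 hv]
  · exact fun h => ⟨K.liftQ A h, K.liftQ_mkQ A h⟩

lemma finrank_range_lcomp_mkQ [FiniteDimensional F V] [FiniteDimensional F E] (K : Submodule F V) :
    finrank F (LinearMap.lcomp F E K.mkQ).range
      = (finrank F V - finrank F K) * finrank F E := by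
  rw [LinearMap.finrank_range_of_inj, finrank_linearMap, finrank_quotient]
  intro f g hfg
  exact K.linearMap_qext hfg

lemma mem_range_compRight_subtype {U : Submodule F E} {A : V →ₗ[F] E} :
    A ∈ (LinearMap.compRight F (M := V) U.subtype).range ↔ A.range ≤ U := by
  constructor
  · rintro ⟨g, rfl⟩ _ ⟨v, rfl⟩
    exact (g v).2
  · exact fun h => ⟨A.codRestrict U fun v => h ⟨v, rfl⟩, rfl⟩

lemma finrank_range_compRight_subtype [FiniteDimensional F V] [FiniteDimensional F E]
    (U : Submodule F E) :
    finrank F (LinearMap.compRight F (M := V) U.subtype).range = finrank F V * finrank F U := by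
  rw [LinearMap.finrank_range_of_inj, finrank_linearMap]
  intro f g hfg
  ext v
  exact LinearMap.congr_fun hfg v

/-- A space of maps of rank at most `s` of the maximal dimension `s * finrank F E` contains, for
each `i ≤ s`, a space of maps of rank at most `i` of dimension `i * finrank F E`. -/
lemma exists_le_finrank_eq_mul [FiniteDimensional F V] [FiniteDimensional F E]
    {B : Submodule F (V →ₗ[F] E)} {s : ℕ}
    (hB : ∀ A ∈ B, finrank F A.range ≤ s) (hVE : finrank F V ≤ finrank F E)
    (hdim : finrank F B = s * finrank F E) (hsV : s ≤ finrank F V) {i : ℕ} (hi : i ≤ s) :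
    ∃ B' ≤ B, finrank F B' = i * finrank F E ∧ ∀ A ∈ B', finrank F A.range ≤ i := by
  rcases exists_le_ker_or_range_le hB hVE hdim with ⟨K, hK, hBK⟩ | ⟨hVE', U, hU, hBU⟩
  · have hBeq : B = (LinearMap.lcomp F E K.mkQ).range := by
      refine eq_of_le_of_finrank_le (fun A hA => mem_range_lcomp_mkQ.2 (hBK A hA)) ?_
      rw [finrank_range_lcomp_mkQ, hdim]
      exact Nat.mul_le_mul_right _ (by omega)
    have hKd : finrank F K ≤ finrank F V - i := by
      rw [hBeq, finrank_range_lcomp_mkQ] at hdim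
      have := K.finrank_le
      rcases mul_eq_mul_right_iff.1 hdim with h | h <;> omega
    obtain ⟨L, hL, -, hLd⟩ := exists_finrank_eq_between (le_top (a := K)) hKd
      (by rw [finrank_top]; omega)
    refine ⟨(LinearMap.lcomp F E L.mkQ).range, fun A hA => ?_, ?_, fun A hA => ?_⟩
    · rw [hBeq, mem_range_lcomp_mkQ]
      exact hL.trans (mem_range_lcomp_mkQ.1 hA)
    · rw [finrank_range_lcomp_mkQ, hLd, Nat.sub_sub_self (hi.trans hsV)]
    · have h1 := finrank_mono (mem_range_lcomp_mkQ.1 hA)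
      have h2 := A.finrank_range_add_finrank_ker
      omega
  · have hBeq : B = (LinearMap.compRight F U.subtype).range := by
      refine eq_of_le_of_finrank_le (fun A hA => mem_range_compRight_subtype.2 (hBU A hA)) ?_
      rw [finrank_range_compRight_subtype, hdim, hVE', mul_comm]
      exact Nat.mul_le_mul_right _ hU
    have hUd : i ≤ finrank F U := by
      rw [hBeq, finrank_range_compRight_subtype, hVE', mul_comm] at hdim
      rcases mul_eq_mul_right_iff.1 hdim with h | h <;> omega
    obtain ⟨W, -, hW, hWd⟩ := exists_finrank_eq_between (bot_le (a := U))
      (by rw [finrank_bot]; omega) hUd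
    refine ⟨(LinearMap.compRight F W.subtype).range, fun A hA => ?_, ?_, fun A hA => ?_⟩
    · rw [hBeq, mem_range_compRight_subtype]
      exact (mem_range_compRight_subtype.1 hA).trans hW
    · rw [finrank_range_compRight_subtype, hWd, hVE', mul_comm]
    · exact (finrank_mono (mem_range_compRight_subtype.1 hA)).trans hWd.le

section Matrix

variable {n m : ℕ}

/-- Matrices as linear maps acting on row vectors. -/
def rowMap : Matrix (Fin n) (Fin m) F ≃ₗ[F] (Fin n → F) →ₗ[F] Fin m → F :=
  (transposeLinearEquiv (Fin n) (Fin m) F F).trans toLin'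

lemma finrank_range_rowMap (A : Matrix (Fin n) (Fin m) F) :
    finrank F (rowMap A).range = A.rank := by
  rw [← rank_transpose, Matrix.rank, ← toLin'_apply']
  rfl

lemma rank_le_maxrk {C : Submodule F (Matrix (Fin n) (Fin m) F)} {A : Matrix (Fin n) (Fin m) F}
    (hA : A ∈ C) : A.rank ≤ maxrk C := by
  refine le_csSup ⟨n, ?_⟩ ⟨A, hA, rfl⟩
  rintro _ ⟨A, -, rfl⟩
  simpa using A.rank_le_card_height

lemma maxrk_le {C : Submodule F (Matrix (Fin n) (Fin m) F)} {i : ℕ}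
    (h : ∀ A ∈ C, A.rank ≤ i) : maxrk C ≤ i := by
  refine csSup_le ⟨_, 0, C.zero_mem, rfl⟩ ?_
  rintro _ ⟨A, hA, rfl⟩
  exact h A hA

lemma finrank_range_le_of_mem_map {C : Submodule F (Matrix (Fin n) (Fin m) F)} {i : ℕ}
    (h : ∀ A ∈ C, A.rank ≤ i) :
    ∀ A ∈ C.map (rowMap : _ ≃ₗ[F] _).toLinearMap, finrank F A.range ≤ i := by
  rintro _ ⟨A, hA, rfl⟩
  exact (finrank_range_rowMap A).trans_le (h A hA)

/-- The anticode bound. -/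
lemma finrank_le_maxrk_mul (hnm : n ≤ m) (C : Submodule F (Matrix (Fin n) (Fin m) F)) :
    finrank F C ≤ maxrk C * m := by
  have := finrank_le_mul (finrank_range_le_of_mem_map fun A (hA : A ∈ C) => rank_le_maxrk hA)
    (by simpa using hnm)
  simpa [LinearEquiv.finrank_map_eq] using this

lemma isOptAnticode_of_rank_le (hnm : n ≤ m) (hm : 0 < m)
    {C : Submodule F (Matrix (Fin n) (Fin m) F)} {i : ℕ} (hC : finrank F C = i * m)
    (h : ∀ A ∈ C, A.rank ≤ i) : isOptAnticode C := by
  have h1 := finrank_le_maxrk_mul hnm C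
  rw [hC] at h1
  rw [isOptAnticode, hC, mul_comm,
    le_antisymm (Nat.le_of_mul_le_mul_right h1 hm) (maxrk_le h)]

lemma exists_isOptAnticode_le (hnm : n ≤ m) (hm : 0 < m) {s i : ℕ} (hsn : s ≤ n) (hi : i ≤ s)
    {C : Submodule F (Matrix (Fin n) (Fin m) F)} (hC : isOptAnticode C)
    (hdim : finrank F C = s * m) :
    ∃ D ≤ C, isOptAnticode D ∧ finrank F D = i * m := by
  have hs : maxrk C = s := by
    rw [isOptAnticode, hdim, mul_comm] at hC
    exact (Nat.eq_of_mul_eq_mul_left hm hC).symm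
  obtain ⟨B, hBC, hBd, hB⟩ := exists_le_finrank_eq_mul (s := s) (i := i)
    (finrank_range_le_of_mem_map fun A (hA : A ∈ C) => (rank_le_maxrk hA).trans hs.le)
    (by simpa using hnm) (by simpa [LinearEquiv.finrank_map_eq] using hdim)
    (by simpa using hsn) hi
  have hD : finrank F (B.map (rowMap : _ ≃ₗ[F] _).symm.toLinearMap) = i * m := by
    rw [LinearEquiv.finrank_map_eq, hBd]
    simp
  refine ⟨_, ?_, isOptAnticode_of_rank_le hnm hm hD ?_, hD⟩
  · rintro _ ⟨A, hA, rfl⟩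
    obtain ⟨A, hAC, rfl⟩ := hBC hA
    simpa using hAC
  · rintro _ ⟨A, hA, rfl⟩
    rw [← finrank_range_rowMap]
    refine (congrArg (fun f => finrank F (LinearMap.range f)) (rowMap.apply_symm_apply A)).trans_le ?_
    exact hB A hA

end Matrix

end OptAnticode

/-- If `C` contains an optimal anticode of dimension `sm`, then
`a_j(C) = i` for `(i−1)m + 1 ≤ j ≤ im` and `1 ≤ i ≤ s`. -/
theorem stmt6 {𝔽 : Type*} [Field 𝔽] [Fintype 𝔽] {n m s : ℕ} (hn : 1 ≤ n) (hnm : n ≤ m)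
    (hs1 : 1 ≤ s) (hsn : s ≤ n)
    (C : Submodule 𝔽 (Matrix (Fin n) (Fin m) 𝔽))
    (hA : ∃ A : Submodule 𝔽 (Matrix (Fin n) (Fin m) 𝔽),
        isOptAnticode A ∧ A ≤ C ∧ Module.finrank 𝔽 A = s * m) :
    ∀ i : ℕ, 1 ≤ i → i ≤ s → ∀ j : ℕ, (i - 1) * m + 1 ≤ j → j ≤ i * m →
      sInf {d : ℕ | ∃ A : Submodule 𝔽 (Matrix (Fin n) (Fin m) 𝔽),
          isOptAnticode A ∧ j ≤ Module.finrank 𝔽 ↥(A ⊓ C) ∧ Module.finrank 𝔽 A = d}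
        = i * m := by
  intro i hi his j hij hj
  have hm : 0 < m := by omega
  obtain ⟨A, hAopt, hAC, hAd⟩ := hA
  obtain ⟨D, hDA, hDopt, hDd⟩ := OptAnticode.exists_isOptAnticode_le hnm hm hsn his hAopt hAd
  have hmem : i * m ∈ {d : ℕ | ∃ A : Submodule 𝔽 (Matrix (Fin n) (Fin m) 𝔽),
      isOptAnticode A ∧ j ≤ Module.finrank 𝔽 ↥(A ⊓ C) ∧ Module.finrank 𝔽 A = d} :=
    ⟨D, hDopt, by rwa [inf_eq_left.2 (hDA.trans hAC), hDd], hDd⟩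
  refine le_antisymm (Nat.sInf_le hmem) (le_csInf ⟨_, hmem⟩ ?_)
  rintro d ⟨A', hopt, hjA, rfl⟩
  have hle : Module.finrank 𝔽 ↥(A' ⊓ C) ≤ Module.finrank 𝔽 A' :=
    Submodule.finrank_mono inf_le_left
  rw [isOptAnticode, mul_comm] at hopt
  have hlt : (i - 1) * m < maxrk A' * m := by omega
  have := Nat.lt_of_mul_lt_mul_right hlt
  rw [hopt]
  exact Nat.mul_le_mul_right m (by omega)
end

section
/- Let 0 ≤ s ≤ n ≤ m, 0 ≤ k ≤ m, and let C = Mat(⟨e_1,…,e_s⟩) + Mat(⟨e_1,…,e_k⟩)^t ⊆ F_q^{n×m}. Then for every 1 ≤ i ≤ s and every j with (i−1)m + 1 ≤ j ≤ im, the minimum dimension of an optimal anticode A ⊆ F_q^{n×m} with dim(A ∩ C) ≥ j equals im; that is, a_j(C) = i. -/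
open Matrix

/-- A matrix in `Mat(V)` is a choice of `m` columns in `V`. -/
def matColEquiv {𝔽 : Type*} [Field 𝔽] {n m : ℕ} (V : Submodule 𝔽 (Fin n → 𝔽)) :
    (matCol V : Submodule 𝔽 (Matrix (Fin n) (Fin m) 𝔽)) ≃ₗ[𝔽] (Fin m → V) where
  toFun M j := ⟨fun i => M.1 i j, M.2 j⟩
  invFun f := ⟨Matrix.of fun i j => (f j).1 i, fun j => (f j).2⟩
  map_add' _ _ := rfl
  map_smul' _ _ := rfl
  left_inv _ := rfl
  right_inv _ := rfl

theorem finrank_matCol {𝔽 : Type*} [Field 𝔽] {n : ℕ} (m : ℕ) (V : Submodule 𝔽 (Fin n → 𝔽)) :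
    Module.finrank 𝔽 (matCol V : Submodule 𝔽 (Matrix (Fin n) (Fin m) 𝔽)) =
      m * Module.finrank 𝔽 V := by
  rw [(matColEquiv V).finrank_eq, Module.finrank_pi_fintype]
  simp

theorem rank_le_of_mem_matCol {𝔽 : Type*} [Field 𝔽] {n m : ℕ} {V : Submodule 𝔽 (Fin n → 𝔽)}
    {M : Matrix (Fin n) (Fin m) 𝔽} (hM : M ∈ matCol V) : M.rank ≤ Module.finrank 𝔽 V := by
  rw [Matrix.rank_eq_finrank_span_cols]
  refine Submodule.finrank_mono (Submodule.span_le.2 ?_)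
  rintro _ ⟨j, rfl⟩
  exact hM j

theorem exists_mem_matCol_rank_eq {𝔽 : Type*} [Field 𝔽] {n m : ℕ} {V : Submodule 𝔽 (Fin n → 𝔽)}
    (hV : Module.finrank 𝔽 V ≤ m) :
    ∃ M ∈ (matCol V : Submodule 𝔽 (Matrix (Fin n) (Fin m) 𝔽)),
      M.rank = Module.finrank 𝔽 V := by
  let b := Module.finBasis 𝔽 V
  let f : Fin m → V := fun j => if h : j < Module.finrank 𝔽 V then b ⟨j, h⟩ else 0
  have hM := ((matColEquiv V).symm f).2
  refine ⟨_, hM, (rank_le_of_mem_matCol hM).antisymm ?_⟩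
  rw [Matrix.rank_eq_finrank_span_cols,
    ← finrank_span_eq_card (b.linearIndependent.map' V.subtype V.ker_subtype) |>.trans
      (Fintype.card_fin _)]
  refine Submodule.finrank_mono (Submodule.span_mono ?_)
  rintro _ ⟨t, rfl⟩
  refine ⟨⟨t, t.2.trans_le hV⟩, ?_⟩
  change (f _ : Fin n → 𝔽) = _
  simp [f]

theorem maxrk_matCol {𝔽 : Type*} [Field 𝔽] {n m : ℕ} {V : Submodule 𝔽 (Fin n → 𝔽)}
    (hV : Module.finrank 𝔽 V ≤ m) :
    maxrk (matCol V : Submodule 𝔽 (Matrix (Fin n) (Fin m) 𝔽)) = Module.finrank 𝔽 V := by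
  obtain ⟨M, hM, hr⟩ := exists_mem_matCol_rank_eq hV
  refine IsGreatest.csSup_eq ⟨⟨M, hM, hr⟩, ?_⟩
  rintro _ ⟨N, hN, rfl⟩
  exact rank_le_of_mem_matCol hN

theorem isOptAnticode_matCol {𝔽 : Type*} [Field 𝔽] {n m : ℕ} {V : Submodule 𝔽 (Fin n → 𝔽)}
    (hV : Module.finrank 𝔽 V ≤ m) :
    isOptAnticode (matCol V : Submodule 𝔽 (Matrix (Fin n) (Fin m) 𝔽)) := by
  rw [isOptAnticode, finrank_matCol, maxrk_matCol hV]

theorem matCol_mono {𝔽 : Type*} [Field 𝔽] {n m : ℕ} {V W : Submodule 𝔽 (Fin n → 𝔽)}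
    (h : V ≤ W) : (matCol V : Submodule 𝔽 (Matrix (Fin n) (Fin m) 𝔽)) ≤ matCol W :=
  fun _ hM j => h (hM j)

theorem spanFirst_mono (𝔽 : Type*) [Field 𝔽] (ℓ : ℕ) {s t : ℕ} (h : s ≤ t) :
    spanFirst 𝔽 ℓ s ≤ spanFirst 𝔽 ℓ t :=
  Submodule.span_mono (Set.image_mono fun _ hi => lt_of_lt_of_le hi h)

theorem finrank_spanFirst (𝔽 : Type*) [Field 𝔽] {ℓ s : ℕ} (h : s ≤ ℓ) :
    Module.finrank 𝔽 (spanFirst 𝔽 ℓ s) = s := by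
  have hset : {i : Fin ℓ | (i : ℕ) < s} = Set.range (Fin.castLE h) := by
    simp
  have hli : LinearIndependent 𝔽 ((fun i : Fin ℓ => Pi.single i (1 : 𝔽)) ∘ Fin.castLE h) :=
    (Pi.linearIndependent_single_one (Fin ℓ) 𝔽).comp _ (Fin.castLE_injective h)
  rw [spanFirst, hset, ← Set.range_comp, finrank_span_eq_card hli, Fintype.card_fin]

/-- For `C = Mat(⟨e_1,…,e_s⟩) + Mat(⟨e_1,…,e_k⟩)ᵗ`,
`a_j(C) = i` for `(i−1)m + 1 ≤ j ≤ im` and `1 ≤ i ≤ s`. -/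
theorem stmt7 {𝔽 : Type*} [Field 𝔽] [Fintype 𝔽] {n m s k : ℕ}
    (hsn : s ≤ n) (hnm : n ≤ m) (hkm : k ≤ m)
    (C : Submodule 𝔽 (Matrix (Fin n) (Fin m) 𝔽))
    (hC : C = matCol (spanFirst 𝔽 n s) ⊔ matRow (spanFirst 𝔽 m k)) :
    ∀ i : ℕ, 1 ≤ i → i ≤ s → ∀ j : ℕ, (i - 1) * m + 1 ≤ j → j ≤ i * m →
      sInf {d : ℕ | ∃ A : Submodule 𝔽 (Matrix (Fin n) (Fin m) 𝔽),
          isOptAnticode A ∧ j ≤ Module.finrank 𝔽 ↥(A ⊓ C) ∧ Module.finrank 𝔽 A = d}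
        = i * m := by
  intro i hi his j hj hji
  have hrk := finrank_spanFirst 𝔽 (his.trans hsn)
  have hdim : Module.finrank 𝔽
      (matCol (spanFirst 𝔽 n i) : Submodule 𝔽 (Matrix (Fin n) (Fin m) 𝔽)) = i * m := by
    rw [finrank_matCol, hrk, mul_comm]
  refine IsLeast.csInf_eq ⟨⟨matCol (spanFirst 𝔽 n i), ?_, ?_, hdim⟩, ?_⟩
  · exact isOptAnticode_matCol (by omega)
  · rwa [inf_eq_left.2, hdim]
    rw [hC]
    exact (matCol_mono (spanFirst_mono 𝔽 n his)).trans le_sup_left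
  · rintro _ ⟨A, hA, hjA, rfl⟩
    have hlt : (i - 1) * m < maxrk A * m := by
      rw [mul_comm (maxrk A), ← hA]
      exact hj.trans (hjA.trans (Submodule.finrank_mono inf_le_left))
    have hle : i ≤ maxrk A := by
      have := lt_of_mul_lt_mul_right hlt m.zero_le
      omega
    rw [hA, mul_comm m]
    exact Nat.mul_le_mul_right m hle
end

section
/- Let 0 ≤ s ≤ n ≤ m, 0 ≤ k ≤ m, and let C = Mat(⟨e_1,…,e_s⟩) + Mat(⟨e_1,…,e_k⟩)^t ⊆ F_q^{n×m}. Then for every 1 ≤ i ≤ n−s and every subspace V ⊆ F_q^n with dim(V) = s + i, one has dim(C ∩ Mat(V)) ≤ sm + ik. -/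
open Matrix

theorem finrank_le_sum_of_columns_mem {𝔽 : Type*} [Field 𝔽] {n m : ℕ}
    (D : Submodule 𝔽 (Matrix (Fin n) (Fin m) 𝔽)) (W : Fin m → Submodule 𝔽 (Fin n → 𝔽))
    (h : ∀ M ∈ D, ∀ j, (fun i => M i j) ∈ W j) :
    Module.finrank 𝔽 D ≤ ∑ j, Module.finrank 𝔽 (W j) := by
  let f : D →ₗ[𝔽] ∀ j, W j :=
    { toFun := fun M j => ⟨fun i => M.1 i j, h M.1 M.2 j⟩
      map_add' := fun _ _ => rfl
      map_smul' := fun _ _ => rfl }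
  rw [← Module.finrank_pi_fintype]
  refine LinearMap.finrank_le_finrank_of_injective (f := f) fun M N hMN => ?_
  ext i j
  exact congrFun (congrArg Subtype.val (congrFun hMN j)) i

theorem finrank_spanFirst_le (𝔽 : Type*) [Field 𝔽] (ℓ s : ℕ) :
    Module.finrank 𝔽 (spanFirst 𝔽 ℓ s) ≤ s := by
  classical
  let t : Finset (Fin ℓ) := {i | (i : ℕ) < s}
  have ht : spanFirst 𝔽 ℓ s =
      Submodule.span 𝔽 (t.image fun i => (Pi.single i 1 : Fin ℓ → 𝔽) : Finset (Fin ℓ → 𝔽)) := by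
    simp [spanFirst, t]
  rw [ht]
  refine (finrank_span_finset_le_card _).trans (Finset.card_image_le.trans ?_)
  simp [t, Fin.card_filter_val_lt]

theorem apply_eq_zero_of_mem_spanFirst {𝔽 : Type*} [Field 𝔽] {ℓ s : ℕ} {v : Fin ℓ → 𝔽}
    (hv : v ∈ spanFirst 𝔽 ℓ s) {j : Fin ℓ} (hj : s ≤ j) : v j = 0 := by
  have hle : spanFirst 𝔽 ℓ s ≤ LinearMap.ker (LinearMap.proj j : (Fin ℓ → 𝔽) →ₗ[𝔽] 𝔽) := by
    refine Submodule.span_le.mpr ?_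
    rintro _ ⟨i, hi, rfl⟩
    have hij : j ≠ i := by
      rintro rfl
      exact absurd hi (not_lt.mpr hj)
    simp [hij]
  exact hle hv

theorem column_mem_spanFirst_of_mem_sup {𝔽 : Type*} [Field 𝔽] {n m s k : ℕ}
    {M : Matrix (Fin n) (Fin m) 𝔽}
    (hM : M ∈ matCol (spanFirst 𝔽 n s) ⊔ matRow (spanFirst 𝔽 m k)) {j : Fin m} (hj : k ≤ j) :
    (fun i => M i j) ∈ spanFirst 𝔽 n s := by
  obtain ⟨A, hA, B, hB, rfl⟩ := Submodule.mem_sup.mp hM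
  have hcol : (fun i => (A + B) i j) = fun i => A i j := by
    funext i
    simp [apply_eq_zero_of_mem_spanFirst (hB i) hj]
  rw [hcol]
  exact hA j

/-- For `C = Mat(⟨e_1,…,e_s⟩) + Mat(⟨e_1,…,e_k⟩)ᵗ` and any subspace
`V ⊆ 𝔽^n` of dimension `s + i` (`1 ≤ i ≤ n − s`), `dim(C ∩ Mat(V)) ≤ sm + ik`. -/
theorem stmt9 {𝔽 : Type*} [Field 𝔽] [Fintype 𝔽] {n m s k : ℕ}
    (hsn : s ≤ n) (hnm : n ≤ m) (hkm : k ≤ m)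
    (C : Submodule 𝔽 (Matrix (Fin n) (Fin m) 𝔽))
    (hC : C = matCol (spanFirst 𝔽 n s) ⊔ matRow (spanFirst 𝔽 m k)) :
    ∀ i : ℕ, 1 ≤ i → i ≤ n - s →
      ∀ V : Submodule 𝔽 (Fin n → 𝔽), Module.finrank 𝔽 V = s + i →
        Module.finrank 𝔽 ↥(C ⊓ matCol V) ≤ s * m + i * k := by
  intro i _ _ V hV
  subst hC
  let W : Fin m → Submodule 𝔽 (Fin n → 𝔽) := fun j => if (j : ℕ) < k then V else spanFirst 𝔽 n s
  have hW : ∀ j, Module.finrank 𝔽 (W j) ≤ s + if (j : ℕ) < k then i else 0 := by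
    intro j
    by_cases hj : (j : ℕ) < k
    · rw [show W j = V from if_pos hj, hV, if_pos hj]
    · rw [show W j = spanFirst 𝔽 n s from if_neg hj, if_neg hj]
      exact finrank_spanFirst_le 𝔽 n s
  calc
    _ ≤ ∑ j, Module.finrank 𝔽 (W j) := by
      refine finrank_le_sum_of_columns_mem _ W fun M hM j => ?_
      by_cases hj : (j : ℕ) < k
      · simpa [W, hj] using hM.2 j
      · simpa [W, hj] using column_mem_spanFirst_of_mem_sup hM.1 (not_lt.mp hj)
    _ ≤ ∑ j : Fin m, (s + if (j : ℕ) < k then i else 0) := Finset.sum_le_sum fun j _ => hW j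
    _ = s * m + i * k := by
      rw [Finset.sum_add_distrib, ← Finset.sum_filter, Finset.sum_const, Finset.sum_const,
        Fin.card_filter_val_lt, min_eq_right hkm]
      simp [mul_comm]
end

section
/- Let h ≥ 0, 0 ≤ k ≤ m, 0 ≤ s ≤ m−h, and let C = Mat(⟨e_1,…,e_s⟩) + Mat(⟨e_1,…,e_k⟩)^t ⊆ F_q^{(s+h)×m}. If J ⊆ F_q^{s+h} is a subspace with J ∩ ⟨e_1,…,e_s⟩ = 0, then dim(C ∩ Mat(J)) = k·dim(J). -/
open Matrix

/-- The span of the first `s` canonical basis vectors consists of the vectors supported on the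
first `s` coordinates. -/
theorem mem_spanFirst_iff {𝔽 : Type*} [Field 𝔽] {ℓ s : ℕ} {v : Fin ℓ → 𝔽} :
    v ∈ spanFirst 𝔽 ℓ s ↔ ∀ i : Fin ℓ, s ≤ (i : ℕ) → v i = 0 := by
  constructor
  · intro hv
    induction hv using Submodule.span_induction with
    | mem x hx =>
      obtain ⟨j, hj, rfl⟩ := hx
      intro i hi
      have hij : i ≠ j := by
        rintro rfl
        exact absurd hj (not_lt.mpr hi)
      simp [hij]
    | zero => simp
    | add x y _ _ hx hy => intro i hi; simp [hx i hi, hy i hi]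
    | smul c x _ hx => intro i hi; simp [hx i hi]
  · intro hv
    rw [pi_eq_sum_univ' v]
    refine Submodule.sum_mem _ fun i _ => ?_
    by_cases hi : (i : ℕ) < s
    · refine Submodule.smul_mem _ _ (Submodule.subset_span ⟨i, hi, ?_⟩)
      ext j
      simp [Pi.single_apply, eq_comm]
    · simp [hv i (not_lt.mp hi)]

/-- Intersecting with `Mat(J)` only sees the row part of `Mat(V) + Mat(⟨e_1, …, e_k⟩)ᵗ` when
`J ∩ V = 0`. -/
theorem matCol_sup_matRow_spanFirst_inf_matCol {𝔽 : Type*} [Field 𝔽] {n m k : ℕ}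
    {V J : Submodule 𝔽 (Fin n → 𝔽)} (hJ : J ⊓ V = ⊥) :
    (matCol V ⊔ matRow (spanFirst 𝔽 m k)) ⊓ matCol J =
      matRow (spanFirst 𝔽 m k) ⊓ matCol J := by
  refine le_antisymm ?_ (inf_le_inf_right _ le_sup_right)
  rintro M ⟨hM, hMJ⟩
  refine ⟨fun i => mem_spanFirst_iff.mpr fun j hj => ?_, hMJ⟩
  obtain ⟨A, hA, B, hB, rfl⟩ := Submodule.mem_sup.mp hM
  have hcol : (fun i => (A + B) i j) = fun i => A i j := by
    ext i
    simp [mem_spanFirst_iff.mp (hB i) j hj]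
  have hmem : (fun i => (A + B) i j) ∈ J ⊓ V := ⟨hMJ j, hcol ▸ hA j⟩
  rw [hJ, Submodule.mem_bot] at hmem
  exact congrFun hmem i

/-- Matrices with columns in `J` that vanish beyond column `k` are `k`-tuples of elements
of `J`. -/
def matRowSpanFirstInfMatColEquiv {𝔽 : Type*} [Field 𝔽] {n m k : ℕ} (hkm : k ≤ m)
    (J : Submodule 𝔽 (Fin n → 𝔽)) :
    ↥(matRow (spanFirst 𝔽 m k) ⊓ matCol J) ≃ₗ[𝔽] (Fin k → J) where
  toFun M j := ⟨fun i => M.1 i (Fin.castLE hkm j), M.2.2 _⟩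
  map_add' _ _ := rfl
  map_smul' _ _ := rfl
  invFun f := ⟨fun i j => if hj : (j : ℕ) < k then (f ⟨j, hj⟩ : Fin n → 𝔽) i else 0,
    fun _ => mem_spanFirst_iff.mpr fun _ hj => dif_neg (not_lt.mpr hj), fun j => by
      by_cases hj : (j : ℕ) < k
      · simp [hj]
      · simp only [hj, dite_false]
        exact J.zero_mem⟩
  left_inv M := by
    ext i j
    by_cases hj : (j : ℕ) < k
    · simp [hj]
    · simp [hj, mem_spanFirst_iff.mp (M.2.1 i) j (not_lt.mp hj)]
  right_inv f := by
    ext j i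
    simp

/-- For `C = Mat(⟨e_1,…,e_s⟩) + Mat(⟨e_1,…,e_k⟩)ᵗ ⊆ 𝔽^{(s+h)×m}` and a
subspace `J` with `J ∩ ⟨e_1,…,e_s⟩ = 0`, `dim(C ∩ Mat(J)) = k·dim(J)`. -/
theorem stmt12 {𝔽 : Type*} [Field 𝔽] [Fintype 𝔽] {m s h k : ℕ}
    (hm : 1 ≤ m) (hkm : k ≤ m) (hs : s ≤ m - h)
    (C : Submodule 𝔽 (Matrix (Fin (s + h)) (Fin m) 𝔽))
    (hC : C = matCol (spanFirst 𝔽 (s + h) s) ⊔ matRow (spanFirst 𝔽 m k))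
    (J : Submodule 𝔽 (Fin (s + h) → 𝔽)) (hJ : J ⊓ spanFirst 𝔽 (s + h) s = ⊥) :
    Module.finrank 𝔽 ↥(C ⊓ matCol J) = k * Module.finrank 𝔽 J := by
  rw [hC, matCol_sup_matRow_spanFirst_inf_matCol hJ,
    (matRowSpanFirstInfMatColEquiv hkm J).finrank_eq, Module.finrank_pi_fintype]
  simp
end

section
/- Let h ≥ 0, 0 ≤ k ≤ m, 0 ≤ s ≤ m−h, and let C = Mat(⟨e_1,…,e_s⟩) + Mat(⟨e_1,…,e_k⟩)^t ⊆ F_q^{(s+h)×m}. If K ⊆ F_q^m is a subspace with K ∩ ⟨e_1,…,e_k⟩ = 0, then dim(C ∩ Mat(K)^t) = s·dim(K). -/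
open Matrix

/-- If `K` meets `U` trivially, then the matrices of `Mat(⟨e_1,…,e_s⟩) + Mat(U)ᵗ` with rows in `K`
are those with rows in `K` which vanish from row `s` on. -/
theorem mem_sup_inf_matRow_iff {𝔽 : Type*} [Field 𝔽] {n m s : ℕ} {U K : Submodule 𝔽 (Fin m → 𝔽)}
    (hK : K ⊓ U = ⊥) {M : Matrix (Fin n) (Fin m) 𝔽} :
    M ∈ (matCol (spanFirst 𝔽 n s) ⊔ matRow U) ⊓ matRow K ↔
      (∀ i, M i ∈ K) ∧ ∀ i : Fin n, s ≤ (i : ℕ) → M i = 0 := by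
  constructor
  · rintro ⟨hM, hMK⟩
    refine ⟨hMK, fun i hi => ?_⟩
    obtain ⟨A, hA, B, hB, rfl⟩ := Submodule.mem_sup.1 hM
    have hAi : A i = 0 := funext fun j => mem_spanFirst_iff.1 (hA j) i hi
    have hAB : (A + B) i = B i := by
      change A i + B i = B i
      rw [hAi, zero_add]
    have hmem : (A + B) i ∈ K ⊓ U := ⟨hMK i, hAB ▸ hB i⟩
    rwa [hK, Submodule.mem_bot] at hmem
  · rintro ⟨hMK, hM⟩
    exact ⟨Submodule.mem_sup_left fun j =>
      mem_spanFirst_iff.2 fun i hi => congrFun (hM i hi) j, hMK⟩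

/-- The matrices with `s` rows in `K` followed by `h` zero rows are the `s`-tuples in `K`. -/
def rowsEquiv {𝔽 : Type*} [Field 𝔽] {m s h : ℕ} {K : Submodule 𝔽 (Fin m → 𝔽)}
    (W : Submodule 𝔽 (Matrix (Fin (s + h)) (Fin m) 𝔽))
    (hW : ∀ M, M ∈ W ↔ (∀ i, M i ∈ K) ∧ ∀ i : Fin (s + h), s ≤ (i : ℕ) → M i = 0) :
    W ≃ₗ[𝔽] (Fin s → K) where
  toFun M i := ⟨M.1 (Fin.castAdd h i), ((hW M.1).1 M.2).1 _⟩
  map_add' _ _ := rfl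
  map_smul' _ _ := rfl
  invFun f := ⟨Fin.addCases (fun i => (f i : Fin m → 𝔽)) (fun _ => 0), (hW _).2 (by
    constructor
    · intro i
      refine Fin.addCases (fun i => ?_) (fun i => ?_) i
      · simp
      · simp
    · intro i
      refine Fin.addCases (fun i hi => ?_) (fun i _ => ?_) i
      · exact absurd i.2 (not_lt.2 hi)
      · simp)⟩
  left_inv M := by
    refine Subtype.ext (funext fun i => ?_)
    refine Fin.addCases (fun i => ?_) (fun i => ?_) i
    · simp
    · simpa using (((hW M.1).1 M.2).2 (Fin.natAdd s i) (by simp)).symm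
  right_inv f := by
    ext i
    simp

/-- For `C = Mat(⟨e_1,…,e_s⟩) + Mat(⟨e_1,…,e_k⟩)ᵗ ⊆ 𝔽^{(s+h)×m}` and a
subspace `K ⊆ 𝔽^m` with `K ∩ ⟨e_1,…,e_k⟩ = 0`, `dim(C ∩ Mat(K)ᵗ) = s·dim(K)`. -/
theorem stmt13 {𝔽 : Type*} [Field 𝔽] [Fintype 𝔽] {m s h k : ℕ}
    (hm : 1 ≤ m) (hkm : k ≤ m) (hs : s ≤ m - h)
    (C : Submodule 𝔽 (Matrix (Fin (s + h)) (Fin m) 𝔽))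
    (hC : C = matCol (spanFirst 𝔽 (s + h) s) ⊔ matRow (spanFirst 𝔽 m k))
    (K : Submodule 𝔽 (Fin m → 𝔽)) (hK : K ⊓ spanFirst 𝔽 m k = ⊥) :
    Module.finrank 𝔽 ↥(C ⊓ matRow K) = s * Module.finrank 𝔽 K := by
  subst hC
  rw [(rowsEquiv _ fun M => mem_sup_inf_matRow_iff hK).finrank_eq, Module.finrank_pi_fintype]
  simp
end
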